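/- Let n ≥ 2 and assume [B_δ, B_{kδ}] = 0 for all k < n. Then F_{n+1} = B_1B_{nδ} + q²B_{nδ}B_1 − B_{(n−1)δ}B_0 − q²B_0B_{(n−1)δ} + (T_0Φ)^{-1}(F_n), where F_n = q^{-2}[C_{n−1}, B_{δ+α_0}] − [T_0Φ(C_n), B_0] − (q²−q^{-2})B_{δ+α_0}C_{n−1}. -/

import Mathlib

set_option synthInstance.maxHeartbeats 1000000
set_option maxHeartbeats 1000000

noncomputable section

open scoped BigOperators

/-- The field `ℚ(q)` of rational functions. -/
abbrev KK : Type := RatFunc ℚ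

/-- The indeterminate `q ∈ ℚ(q)`. -/
def qq : KK := RatFunc.X

/-- The `q`-Dolan–Grady relations defining the `q`-Onsager algebra `B_c`:
`Σᵢ (−1)ⁱ [3 choose i]_q B₀^{3−i} B₁ B₀^i = −qc(q+q⁻¹)²(B₀B₁ − B₁B₀)` and the
same with `B₀, B₁` interchanged (here `[3 choose 1]_q = [3 choose 2]_q = q² + 1 + q⁻²`). -/
inductive qOnsRel (c : KK) : FreeAlgebra KK (Fin 2) → FreeAlgebra KK (Fin 2) → Prop
  | r0 : qOnsRel c
      (FreeAlgebra.ι KK (0 : Fin 2) ^ 3 * FreeAlgebra.ι KK (1 : Fin 2)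
        - (qq ^ 2 + 1 + (qq⁻¹) ^ 2) • (FreeAlgebra.ι KK (0 : Fin 2) ^ 2 * FreeAlgebra.ι KK (1 : Fin 2) * FreeAlgebra.ι KK (0 : Fin 2))
        + (qq ^ 2 + 1 + (qq⁻¹) ^ 2) • (FreeAlgebra.ι KK (0 : Fin 2) * FreeAlgebra.ι KK (1 : Fin 2) * FreeAlgebra.ι KK (0 : Fin 2) ^ 2)
        - FreeAlgebra.ι KK (1 : Fin 2) * FreeAlgebra.ι KK (0 : Fin 2) ^ 3)
      ((-(qq * c * (qq + qq⁻¹) ^ 2)) •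
        (FreeAlgebra.ι KK (0 : Fin 2) * FreeAlgebra.ι KK (1 : Fin 2) - FreeAlgebra.ι KK (1 : Fin 2) * FreeAlgebra.ι KK (0 : Fin 2)))
  | r1 : qOnsRel c
      (FreeAlgebra.ι KK (1 : Fin 2) ^ 3 * FreeAlgebra.ι KK (0 : Fin 2)
        - (qq ^ 2 + 1 + (qq⁻¹) ^ 2) • (FreeAlgebra.ι KK (1 : Fin 2) ^ 2 * FreeAlgebra.ι KK (0 : Fin 2) * FreeAlgebra.ι KK (1 : Fin 2))
        + (qq ^ 2 + 1 + (qq⁻¹) ^ 2) • (FreeAlgebra.ι KK (1 : Fin 2) * FreeAlgebra.ι KK (0 : Fin 2) * FreeAlgebra.ι KK (1 : Fin 2) ^ 2)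
        - FreeAlgebra.ι KK (0 : Fin 2) * FreeAlgebra.ι KK (1 : Fin 2) ^ 3)
      ((-(qq * c * (qq + qq⁻¹) ^ 2)) •
        (FreeAlgebra.ι KK (1 : Fin 2) * FreeAlgebra.ι KK (0 : Fin 2) - FreeAlgebra.ι KK (0 : Fin 2) * FreeAlgebra.ι KK (1 : Fin 2)))

/-- The `q`-Onsager algebra `B_c`. -/
abbrev QOns (c : KK) : Type := RingQuot (qOnsRel c)

/-- The generator `B₀` of `B_c`. -/
def Bo (c : KK) : QOns c := RingQuot.mkAlgHom KK (qOnsRel c) (FreeAlgebra.ι KK (0 : Fin 2))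

/-- The generator `B₁` of `B_c`. -/
def Bi (c : KK) : QOns c := RingQuot.mkAlgHom KK (qOnsRel c) (FreeAlgebra.ι KK (1 : Fin 2))

/-- `B_δ = −B₀B₁ + q⁻²B₁B₀`. -/
def Bdel (c : KK) : QOns c := -(Bo c * Bi c) + ((qq⁻¹) ^ 2) • (Bi c * Bo c)

/-- `B̃_δ = −B₁B₀ + q⁻²B₀B₁`. -/
def tBdel (c : KK) : QOns c := -(Bi c * Bo c) + ((qq⁻¹) ^ 2) • (Bo c * Bi c)

/-- The formula for `T₀(B₁)`:
`(1/(q²[2]_q c))(B₁B₀² − q[2]_q B₀B₁B₀ + q²B₀²B₁) + B₁`. -/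
def T0B1val (c : KK) : QOns c :=
  (qq ^ 2 * (qq + qq⁻¹) * c)⁻¹ •
    (Bi c * Bo c ^ 2 - (qq * (qq + qq⁻¹)) • (Bo c * Bi c * Bo c) + qq ^ 2 • (Bo c ^ 2 * Bi c))
    + Bi c

/-- The formula for `T₀⁻¹(B₁)`:
`(1/(q²[2]_q c))(B₀²B₁ − q[2]_q B₀B₁B₀ + q²B₁B₀²) + B₁`. -/
def T0invB1val (c : KK) : QOns c :=
  (qq ^ 2 * (qq + qq⁻¹) * c)⁻¹ •
    (Bo c ^ 2 * Bi c - (qq * (qq + qq⁻¹)) • (Bo c * Bi c * Bo c) + qq ^ 2 • (Bi c * Bo c ^ 2))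
    + Bi c

/-- `T₁ = Φ ∘ T₀ ∘ Φ`. -/
def T1def (c : KK) (Φ T0 : QOns c ≃ₐ[KK] QOns c) : QOns c ≃ₐ[KK] QOns c :=
  Φ.trans (T0.trans Φ)

/-- The real root vectors `B_{nδ+α₀} = (T₀Φ)ⁿ(B₀)` for `n ≥ 0`. -/
def Ba0 (c : KK) (Φ T0 : QOns c ≃ₐ[KK] QOns c) (n : ℕ) : QOns c :=
  ((⇑T0 ∘ ⇑Φ)^[n]) (Bo c)

/-- The real root vectors `B_{nδ+α₁} = (T₁⁻¹Φ)ⁿ(B₁)` for `n ≥ 0`. -/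
def Ba1 (c : KK) (Φ T0 : QOns c ≃ₐ[KK] QOns c) (n : ℕ) : QOns c :=
  ((⇑(T1def c Φ T0).symm ∘ ⇑Φ)^[n]) (Bi c)

/-- `B_{kδ+α₁}` for `k ∈ ℤ`, with the convention `B_{kδ+α₁} = B_{(−k−1)δ+α₀}` for `k < 0`. -/
def Ba1Z (c : KK) (Φ T0 : QOns c ≃ₐ[KK] QOns c) (k : ℤ) : QOns c :=
  if 0 ≤ k then Ba1 c Φ T0 k.toNat else Ba0 c Φ T0 (-k - 1).toNat

/-- `B_{kδ+α₀}` for `k ∈ ℤ`, with the convention `B_{kδ+α₀} = B_{(−k−1)δ+α₁}` for `k < 0`. -/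
def Ba0Z (c : KK) (Φ T0 : QOns c ≃ₐ[KK] QOns c) (k : ℤ) : QOns c :=
  if 0 ≤ k then Ba0 c Φ T0 k.toNat else Ba1 c Φ T0 (-k - 1).toNat

/-- `C_m = Σ_{p=0}^{m−2} B_{pδ+α₁} B_{(m−p−2)δ+α₁}` (so `C₀ = C₁ = 0`). -/
def CC (c : KK) (Φ T0 : QOns c ≃ₐ[KK] QOns c) (m : ℕ) : QOns c :=
  ∑ p ∈ Finset.range (m - 1), Ba1 c Φ T0 p * Ba1 c Φ T0 (m - 2 - p)

/-- The imaginary root vectors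
`B_{mδ} = −B₀B_{(m−1)δ+α₁} + q⁻²B_{(m−1)δ+α₁}B₀ + (q⁻²−1)C_m` for `m ≥ 1`. -/
def Bim (c : KK) (Φ T0 : QOns c ≃ₐ[KK] QOns c) (m : ℕ) : QOns c :=
  -(Bo c * Ba1 c Φ T0 (m - 1)) + ((qq⁻¹) ^ 2) • (Ba1 c Φ T0 (m - 1) * Bo c)
    + (((qq⁻¹) ^ 2 - 1)) • CC c Φ T0 m


/-- `F_n = q⁻²[C_{n−1}, B_{δ+α₀}] − [T₀Φ(C_n), B₀] − (q²−q⁻²)B_{δ+α₀}C_{n−1}`,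
where `B_{δ+α₀} = T₀(B₁)`. -/
def FFn (c : KK) (Φ T0 : QOns c ≃ₐ[KK] QOns c) (n : ℕ) : QOns c :=
  ((qq⁻¹) ^ 2) • (CC c Φ T0 (n - 1) * T0 (Bi c) - T0 (Bi c) * CC c Φ T0 (n - 1))
    - (T0 (Φ (CC c Φ T0 (n))) * Bo c - Bo c * T0 (Φ (CC c Φ T0 (n))))
    - (qq ^ 2 - (qq⁻¹) ^ 2) • (T0 (Bi c) * CC c Φ T0 (n - 1))

set_option linter.unusedSimpArgs false

section core

/-- Commutator of `D` with the generating series of the imaginary root vectors. -/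
theorem core_comm {K R : Type*} [Field K] [Ring R] [Algebra K R] (p κ : K)
    (t a b e X Y Z D : R) (hta : a * t = t * a) (htb : b * t = t * b) (hte : e * t = t * e)
    (htY : Y * t = t * Y) (hX : X = e + t * Y) (hZ : Z = a + t * X)
    (hDa : D * a = a * D + κ • (b - e)) (hDX : D * X = X * D + κ • (Z - Y))
    (htD : D * t = t * D) :
    t * (D * (-(a * X) + p • (X * a) + (p - 1) • (t * X * X))
      - (-(a * X) + p • (X * a) + (p - 1) • (t * X * X)) * D)
    = κ • ((-(b * Z) + p • (Z * b) + (p - 1) • (t * Z * Z)) - (-(b * a) + p • (a * b))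
      - (-(a * X) + p • (X * a) + (p - 1) • (t * X * X)) + (-(a * e) + p • (e * a))
      + t * t * ((-(a * X) + p • (X * a) + (p - 1) • (t * X * X))
        - (-(e * Y) + p • (Y * e) + (p - 1) • (t * Y * Y)))) := by
  have s {u v w : R} (h : u * v = w) (z : R) : u * (v * z) = w * z := by rw [← mul_assoc, h]
  have htX : X * t = t * X := by
    subst hX; simp only [mul_add, add_mul, hte, mul_assoc, htY]
  have h1 : D * (-(a * X) + p • (X * a) + (p - 1) • (t * X * X))
      - (-(a * X) + p • (X * a) + (p - 1) • (t * X * X)) * D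
      = κ • (-((b - e) * X) - a * (Z - Y) + p • ((Z - Y) * a) + p • (X * (b - e))
        + (p - 1) • (t * (Z - Y) * X + t * X * (Z - Y))) := by
    simp only [mul_add, add_mul, mul_sub, sub_mul, mul_neg, neg_mul, smul_mul_assoc,
      mul_smul_comm, mul_assoc, hDa, hDX, htD, s hDa, s hDX, s htD, smul_sub, smul_add]
    module
  rw [h1]
  subst hZ
  subst hX
  simp only [mul_add, add_mul, mul_sub, sub_mul, mul_neg, neg_mul, smul_mul_assoc,
      mul_smul_comm, mul_assoc, hta, htb, hte, htY, s hta, s htb, s hte, s htY, smul_sub, smul_add]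
  module

/-- The generating series identity, with explicit error terms. -/
theorem core_id {K R : Type*} [Field K] [Ring R] [Algebra K R] (q : K) (hq : q ≠ 0)
    (t a b e X Y Z : R) (hta : a * t = t * a) (htb : b * t = t * b) (hte : e * t = t * e)
    (htY : Y * t = t * Y) (hX : X = e + t * Y) (hZ : Z = a + t * X)
    (β1 β0 β2 : R)
    (h1 : β1 = -(b * Z) + (q⁻¹ ^ 2) • (Z * b) + (q⁻¹ ^ 2 - 1) • (t * Z * Z))
    (h0 : β0 = -(a * X) + (q⁻¹ ^ 2) • (X * a) + (q⁻¹ ^ 2 - 1) • (t * X * X))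
    (h2 : β2 = -(e * Y) + (q⁻¹ ^ 2) • (Y * e) + (q⁻¹ ^ 2 - 1) • (t * Y * Y))
    (hD : -(b * a) + (q⁻¹ ^ 2) • (a * b) = -(a * e) + (q⁻¹ ^ 2) • (e * a)) :
    ((q⁻¹ ^ 2) • (t * X * X * b - b * (t * X * X)) - (Z * Z * a - a * (Z * Z))
      - (q ^ 2 - q⁻¹ ^ 2) • (b * (t * X * X)))
    - (e * β0 + q ^ 2 • (β0 * e) - t * β0 * a - q ^ 2 • (a * (t * β0))
      + ((q⁻¹ ^ 2) • (t * t * Y * Y * a - a * (t * t * Y * Y)) - (t * X * X * e - e * (t * X * X))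
      - (q ^ 2 - q⁻¹ ^ 2) • (a * (t * t * Y * Y))))
    = X * (β1 - β0) + q ^ 2 • ((β1 - β0) * X)
      + t * t * ((β2 - β0) * X + q ^ 2 • (X * (β2 - β0)))
      - (e * (-(a * e) + (q⁻¹ ^ 2) • (e * a)) + q ^ 2 • ((-(a * e) + (q⁻¹ ^ 2) • (e * a)) * e)) := by
  have s {u v w : R} (h : u * v = w) (z : R) : u * (v * z) = w * z := by rw [← mul_assoc, h]
  have hD' : b * a = (q⁻¹ ^ 2) • (a * b) + a * e - (q⁻¹ ^ 2) • (e * a) := by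
    have : b * a = (q⁻¹ ^ 2) • (a * b) - (-(b * a) + (q⁻¹ ^ 2) • (a * b)) := by abel
    rw [this, hD]; abel
  subst h1 h0 h2
  subst hZ
  subst hX
  simp only [mul_add, add_mul, mul_sub, sub_mul, mul_neg, neg_mul, smul_mul_assoc,
      mul_smul_comm, mul_assoc, hta, htb, hte, htY, s hta, s htb, s hte, s htY, hD', s hD',
      smul_sub, smul_add, smul_smul, smul_neg]
  match_scalars <;> field_simp <;> ring

end core

section gf

open PowerSeries

variable {K A : Type*} [Field K] [Ring A] [Algebra K A]

/-- The generating series of the real root vectors, started at `j`. -/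
noncomputable def gX (x : ℤ → A) (j : ℤ) : PowerSeries A := PowerSeries.mk fun i => x (j + i)

/-- The generating series of the (shifted) imaginary root vectors. -/
noncomputable def gB (q : K) (x : ℤ → A) (j : ℤ) : PowerSeries A :=
  -(PowerSeries.C (x (j - 1)) * gX x j) + (q⁻¹ ^ 2) • (gX x j * PowerSeries.C (x (j - 1)))
    + (q⁻¹ ^ 2 - 1) • (PowerSeries.X * gX x j * gX x j)

theorem gX_succ (x : ℤ → A) (j : ℤ) :
    gX x (j - 1) = PowerSeries.C (x (j - 1)) + PowerSeries.X * gX x j := by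
  ext i
  rcases i with _ | i
  · simp [gX]
  · rw [map_add, PowerSeries.coeff_succ_X_mul]
    simp [gX, PowerSeries.coeff_C]

theorem coeff_X_gX (x : ℤ → A) (j : ℤ) (m : ℕ) :
    PowerSeries.coeff m (PowerSeries.X * gX x j * gX x j)
      = ∑ p ∈ Finset.range m, x (j + p) * x (j + (m - 1 - p : ℕ)) := by
  rw [mul_assoc]
  rcases m with _ | m
  · simp
  · rw [PowerSeries.coeff_succ_X_mul, PowerSeries.coeff_mul,
      Finset.Nat.sum_antidiagonal_eq_sum_range_succ_mk]
    simp [gX]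

theorem map_gX (τ : A ≃ₐ[K] A) (x : ℤ → A) (hx : ∀ k, τ (x k) = x (k - 1)) (j : ℤ) :
    PowerSeries.map (τ : A →+* A) (gX x j) = gX x (j - 1) := by
  ext i
  simp [gX, hx]
  congr 1; ring

theorem coeff_map_smul (τ : A ≃ₐ[K] A) (r : K) (f : PowerSeries A) :
    PowerSeries.map (τ : A →+* A) (r • f) = r • PowerSeries.map (τ : A →+* A) f := by
  ext i
  simp

theorem map_gB (q : K) (τ : A ≃ₐ[K] A) (x : ℤ → A) (hx : ∀ k, τ (x k) = x (k - 1)) (j : ℤ) :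
    PowerSeries.map (τ : A →+* A) (gB q x j) = gB q x (j - 1) := by
  simp only [gB, map_add, map_neg, map_mul, coeff_map_smul, map_gX τ x hx, PowerSeries.map_C,
    PowerSeries.map_X]
  simp [hx]

theorem coeff_map_gB (q : K) (τ : A ≃ₐ[K] A) (x : ℤ → A) (hx : ∀ k, τ (x k) = x (k - 1))
    (j : ℤ) (i : ℕ) :
    PowerSeries.coeff i (gB q x (j - 1)) = τ (PowerSeries.coeff i (gB q x j)) := by
  rw [← map_gB q τ x hx]; simp

theorem ad_D (τ : A ≃ₐ[K] A) (x : ℤ → A) (hx : ∀ k, τ (x k) = x (k - 1)) (κ : K) (D : A)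
    (hτD : τ D = D) (hk : D * x (-1) = x (-1) * D + κ • (x (-2) - x 0)) (k : ℤ) :
    D * x k = x k * D + κ • (x (k - 1) - x (k + 1)) := by
  have key : ∀ k : ℤ, (D * x (k - 1) = x (k - 1) * D + κ • (x (k - 1 - 1) - x (k - 1 + 1))) ↔
      (D * x k = x k * D + κ • (x (k - 1) - x (k + 1))) := by
    intro k
    rw [← τ.injective.eq_iff (a := D * x k)]
    simp only [map_mul, map_add, map_sub, map_smul, hτD, hx]
    rw [show k - 1 + 1 = k + 1 - 1 by ring]
  induction k using Int.induction_on with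
  | zero =>
    rw [← key]; norm_num; simpa using hk
  | succ i ih => rw [← key]; simpa using ih
  | pred i ih => rw [key]; exact ih

theorem comm_X (f : PowerSeries A) : f * PowerSeries.X = PowerSeries.X * f :=
  PowerSeries.commute_X f

theorem gB_comm (q κ : K) (x : ℤ → A) (D : A)
    (hD : ∀ k, D * x k = x k * D + κ • (x (k - 1) - x (k + 1))) (m : ℕ) :
    D * PowerSeries.coeff m (gB q x 0) - PowerSeries.coeff m (gB q x 0) * D
    = κ • (PowerSeries.coeff (m + 1) (gB q x (-1)) - PowerSeries.coeff (m + 1) (gB q x 0)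
      + PowerSeries.coeff (m + 1) (PowerSeries.X * (PowerSeries.X * (gB q x 0 - gB q x 1)))) := by
  have h := core_comm (q⁻¹ ^ 2) κ (PowerSeries.X : PowerSeries A) (PowerSeries.C (x (-1)))
    (PowerSeries.C (x (-2))) (PowerSeries.C (x 0)) (gX x 0) (gX x 1) (gX x (-1))
    (PowerSeries.C D) (comm_X _) (comm_X _) (comm_X _) (comm_X _)
    (by simpa using gX_succ x 1) (by simpa using gX_succ x 0)
    (by
      have := congrArg (PowerSeries.C) (hD (-1))
      simpa [PowerSeries.smul_eq_C_mul] using (by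
        rw [← map_mul, this]
        ext i
        rcases i with _ | i <;> simp [PowerSeries.coeff_C] : PowerSeries.C D * PowerSeries.C (x (-1))
          = PowerSeries.C (x (-1)) * PowerSeries.C D
            + κ • (PowerSeries.C (x (-2)) - PowerSeries.C (x 0))))
    (by
      ext i
      simp only [map_add, PowerSeries.coeff_C_mul, PowerSeries.coeff_mul_C, PowerSeries.coeff_smul,
        map_sub]
      simp only [gX, PowerSeries.coeff_mk]
      rw [hD]
      congr 4 <;> ring)
    (comm_X _)
  have h' := congrArg (PowerSeries.coeff (m + 1)) h
  rw [PowerSeries.coeff_succ_X_mul] at h'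
  have e0 : gB q x 0 = -(PowerSeries.C (x (-1)) * gX x 0)
      + (q⁻¹ ^ 2) • (gX x 0 * PowerSeries.C (x (-1)))
      + (q⁻¹ ^ 2 - 1) • (PowerSeries.X * gX x 0 * gX x 0) := by simp [gB]
  have e1 : gB q x 1 = -(PowerSeries.C (x 0) * gX x 1)
      + (q⁻¹ ^ 2) • (gX x 1 * PowerSeries.C (x 0))
      + (q⁻¹ ^ 2 - 1) • (PowerSeries.X * gX x 1 * gX x 1) := by simp [gB]
  have e2 : gB q x (-1) = -(PowerSeries.C (x (-2)) * gX x (-1))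
      + (q⁻¹ ^ 2) • (gX x (-1) * PowerSeries.C (x (-2)))
      + (q⁻¹ ^ 2 - 1) • (PowerSeries.X * gX x (-1) * gX x (-1)) := by simp [gB]
  rw [← e0, ← e1, ← e2] at h'
  rw [map_sub, PowerSeries.coeff_C_mul, PowerSeries.coeff_mul_C] at h'
  rw [h', PowerSeries.coeff_smul, mul_assoc]
  congr 1
  have z : ∀ a b : A, PowerSeries.coeff (m + 1) (-(PowerSeries.C a * PowerSeries.C b)
      + (q⁻¹ ^ 2) • (PowerSeries.C b * PowerSeries.C a)) = 0 := by
    intro a b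
    rw [← map_mul, ← map_mul]
    simp [PowerSeries.coeff_C]
  rw [map_add, map_add, map_sub, map_sub, z, z]
  simp

theorem gB_inv (q κ : K) (hκ : κ ≠ 0) (τ : A ≃ₐ[K] A) (x : ℤ → A)
    (hx : ∀ k, τ (x k) = x (k - 1)) (D : A)
    (hDd : D = -(x (-1) * x 0) + (q⁻¹ ^ 2) • (x 0 * x (-1)))
    (hτD : τ D = D) (hk : D * x (-1) = x (-1) * D + κ • (x (-2) - x 0)) (m : ℕ)
    (hcom : ∀ k, k < m → D * PowerSeries.coeff k (gB q x 0)
      - PowerSeries.coeff k (gB q x 0) * D = 0) :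
    ∀ k, k ≤ m → PowerSeries.coeff k (gB q x (-1)) = PowerSeries.coeff k (gB q x 0) ∧
      PowerSeries.coeff k (gB q x 1) = PowerSeries.coeff k (gB q x 0) := by
  have hiff : ∀ k, PowerSeries.coeff k (gB q x (-1)) = PowerSeries.coeff k (gB q x 0) →
      PowerSeries.coeff k (gB q x 1) = PowerSeries.coeff k (gB q x 0) := by
    intro k h
    apply τ.injective
    rw [← coeff_map_gB q τ x hx, ← coeff_map_gB q τ x hx]
    simpa using h.symm
  have hAD := ad_D τ x hx κ D hτD hk
  intro k
  induction k using Nat.strong_induction_on with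
  | _ k ih =>
    intro hkm
    suffices h : PowerSeries.coeff k (gB q x (-1)) = PowerSeries.coeff k (gB q x 0) from
      ⟨h, hiff k h⟩
    rcases k with _ | k
    · have h0 : PowerSeries.coeff 0 (gB q x 0) = D := by
        rw [hDd]; simp [gB, gX, mul_assoc]
      have := coeff_map_gB q τ x hx 0 0
      rw [h0, hτD] at this
      rw [h0, ← this]; simp
    · have h1 := gB_comm q κ x D hAD k
      rw [hcom k (by omega), PowerSeries.coeff_succ_X_mul] at h1
      have h2 : PowerSeries.coeff k (PowerSeries.X * (gB q x 0 - gB q x 1)) = 0 := by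
        rcases k with _ | k
        · simp
        · rw [PowerSeries.coeff_succ_X_mul, map_sub, (ih k (by omega) (by omega)).2, sub_self]
      rw [h2, add_zero] at h1
      rcases smul_eq_zero.1 h1.symm with h | h
      · exact absurd h hκ
      · exact sub_eq_zero.1 h

theorem gf_main (q κ : K) (hq : q ≠ 0) (hκ : κ ≠ 0) (τ : A ≃ₐ[K] A) (x : ℤ → A)
    (hx : ∀ k, τ (x k) = x (k - 1)) (D : A)
    (hDd : D = -(x (-1) * x 0) + (q⁻¹ ^ 2) • (x 0 * x (-1)))
    (hτD : τ D = D) (hk : D * x (-1) = x (-1) * D + κ • (x (-2) - x 0)) (m : ℕ)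
    (hcom : ∀ k, k < m + 1 → D * PowerSeries.coeff k (gB q x 0)
      - PowerSeries.coeff k (gB q x 0) * D = 0)
    (C : ℕ → A) (hC : ∀ m, C m = PowerSeries.coeff m (PowerSeries.X * gX x 0 * gX x 0)) :
    (q⁻¹ ^ 2) • (C (m + 1) * x (-2) - x (-2) * C (m + 1))
      - (τ (C (m + 2)) * x (-1) - x (-1) * τ (C (m + 2)))
      - (q ^ 2 - q⁻¹ ^ 2) • (x (-2) * C (m + 1))
    = x 0 * PowerSeries.coeff (m + 1) (gB q x 0) + q ^ 2 • (PowerSeries.coeff (m + 1) (gB q x 0) * x 0)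
      - PowerSeries.coeff m (gB q x 0) * x (-1) - q ^ 2 • (x (-1) * PowerSeries.coeff m (gB q x 0))
      + τ.symm ((q⁻¹ ^ 2) • (C m * x (-2) - x (-2) * C m)
      - (τ (C (m + 1)) * x (-1) - x (-1) * τ (C (m + 1)))
      - (q ^ 2 - q⁻¹ ^ 2) • (x (-2) * C m)) := by
  have hinv := gB_inv q κ hκ τ x hx D hDd hτD hk (m + 1) hcom
  have hs : ∀ k, τ.symm (x k) = x (k + 1) := by
    intro k; rw [AlgEquiv.symm_apply_eq, hx]; simp
  have hmapS : ∀ j, PowerSeries.map (τ : A →+* A) (PowerSeries.X * gX x j * gX x j)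
      = PowerSeries.X * gX x (j - 1) * gX x (j - 1) := by
    intro j
    simp only [map_mul, PowerSeries.map_X, map_gX τ x hx]
  have hτC : τ (C (m + 2)) = PowerSeries.coeff (m + 1) (gX x (-1) * gX x (-1)) := by
    have := congrArg (PowerSeries.coeff (m + 2)) (hmapS 0)
    rw [mul_assoc PowerSeries.X (gX x (0 - 1)), PowerSeries.coeff_succ_X_mul] at this
    rw [hC]
    rw [PowerSeries.coeff_map] at this
    simpa using this
  have hsC : τ.symm (C m) = PowerSeries.coeff (m + 1)
      (PowerSeries.X * PowerSeries.X * gX x 1 * gX x 1) := by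
    rw [mul_assoc, mul_assoc, PowerSeries.coeff_succ_X_mul, AlgEquiv.symm_apply_eq, hC,
      ← mul_assoc]
    have := congrArg (PowerSeries.coeff m) (hmapS 1)
    rw [PowerSeries.coeff_map] at this
    simpa using this.symm
  have hτD' : -(x (-2) * x (-1)) + (q⁻¹ ^ 2) • (x (-1) * x (-2))
      = -(x (-1) * x 0) + (q⁻¹ ^ 2) • (x 0 * x (-1)) := by
    rw [← hDd, ← hτD, hDd]; simp [hx]
  have cc : ∀ a b c d : A, -(a * b) + (q⁻¹ ^ 2) • (b * a) = -(c * d) + (q⁻¹ ^ 2) • (d * c) →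
      -((PowerSeries.C a : PowerSeries A) * PowerSeries.C b)
        + (q⁻¹ ^ 2) • (PowerSeries.C b * PowerSeries.C a)
      = -(PowerSeries.C c * PowerSeries.C d) + (q⁻¹ ^ 2) • (PowerSeries.C d * PowerSeries.C c) := by
    intro a b c d h
    ext i
    rcases i with _ | i
    · simpa using h
    · simp only [← map_mul]
      simp [PowerSeries.coeff_C]
  have h := core_id q hq (PowerSeries.X : PowerSeries A) (PowerSeries.C (x (-1)))
    (PowerSeries.C (x (-2))) (PowerSeries.C (x 0)) (gX x 0) (gX x 1) (gX x (-1))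
    (comm_X _) (comm_X _) (comm_X _) (comm_X _)
    (by simpa using gX_succ x 1) (by simpa using gX_succ x 0)
    (gB q x (-1)) (gB q x 0) (gB q x 1) (by simp [gB]) (by simp [gB]) (by simp [gB])
    (cc _ _ _ _ hτD')
  have h' := congrArg (PowerSeries.coeff (m + 1)) h
  have err : ∀ f g : PowerSeries A, (∀ k ≤ m + 1, PowerSeries.coeff k f = 0) →
      ∀ N ≤ m + 1, PowerSeries.coeff N (g * f) = 0 ∧ PowerSeries.coeff N (f * g) = 0 := by
    intro f g hf N hN
    constructor
    · rw [PowerSeries.coeff_mul]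
      refine Finset.sum_eq_zero fun p hp => ?_
      have := Finset.HasAntidiagonal.mem_antidiagonal.1 hp
      rw [hf p.2 (by omega), mul_zero]
    · rw [PowerSeries.coeff_mul]
      refine Finset.sum_eq_zero fun p hp => ?_
      have := Finset.HasAntidiagonal.mem_antidiagonal.1 hp
      rw [hf p.1 (by omega), zero_mul]
  have err1 : ∀ k ≤ m + 1, PowerSeries.coeff k (gB q x (-1) - gB q x 0) = 0 := by
    intro k hk; rw [map_sub, (hinv k hk).1, sub_self]
  have err2 : ∀ k ≤ m + 1, PowerSeries.coeff k (gB q x 1 - gB q x 0) = 0 := by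
    intro k hk; rw [map_sub, (hinv k hk).2, sub_self]
  have hz : PowerSeries.coeff (m + 1) (PowerSeries.X * PowerSeries.X *
      ((gB q x 1 - gB q x 0) * gX x 0 + q ^ 2 • (gX x 0 * (gB q x 1 - gB q x 0)))) = 0 := by
    refine (err _ _ (fun k hk => ?_) _ le_rfl).1
    rw [map_add, PowerSeries.coeff_smul, (err _ _ err2 k hk).1, (err _ _ err2 k hk).2, smul_zero,
      add_zero]
  have hz2 : PowerSeries.coeff (m + 1) (PowerSeries.C (x 0) *
      (-(PowerSeries.C (x (-1)) * PowerSeries.C (x 0))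
        + (q⁻¹ ^ 2) • (PowerSeries.C (x 0) * PowerSeries.C (x (-1))))
      + q ^ 2 • ((-(PowerSeries.C (x (-1)) * PowerSeries.C (x 0))
        + (q⁻¹ ^ 2) • (PowerSeries.C (x 0) * PowerSeries.C (x (-1)))) * PowerSeries.C (x 0))) = 0 := by
    simp only [← map_mul]
    simp [PowerSeries.coeff_C_mul, PowerSeries.coeff_mul_C, PowerSeries.coeff_C]
  have hrhs : PowerSeries.coeff (m + 1) (gX x 0 * (gB q x (-1) - gB q x 0)
      + q ^ 2 • ((gB q x (-1) - gB q x 0) * gX x 0)) = 0 := by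
    rw [map_add, PowerSeries.coeff_smul, (err _ _ err1 _ le_rfl).1, (err _ _ err1 _ le_rfl).2, smul_zero, add_zero]
  rw [map_sub (PowerSeries.coeff (m + 1)) (_ + _), hz2, map_add, hrhs, hz, add_zero, sub_zero] at h'
  have hcR : PowerSeries.coeff (m + 1) (PowerSeries.X * gB q x 0)
      = PowerSeries.coeff m (gB q x 0) := PowerSeries.coeff_succ_X_mul _ _
  simp only [map_sub, map_add, PowerSeries.coeff_smul, PowerSeries.coeff_C_mul,
    PowerSeries.coeff_mul_C, hcR, ← hC, ← hτC, ← hsC] at h'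
  rw [sub_eq_zero] at h'
  rw [h']
  simp only [map_sub, map_smul, map_mul, hs, AlgEquiv.symm_apply_apply]
  norm_num

end gf

theorem qq_ne : qq ≠ 0 := RatFunc.X_ne_zero

theorem two_ne : qq + qq⁻¹ ≠ 0 := by
  intro h
  have hq := qq_ne
  have h1 : qq ^ 2 + 1 = 0 := by
    have : qq * (qq + qq⁻¹) = 0 := by rw [h, mul_zero]
    rw [mul_add, mul_inv_cancel₀ hq] at this
    rw [pow_two]; exact this
  have h2 : (algebraMap (Polynomial ℚ) (RatFunc ℚ)) (Polynomial.X ^ 2 + 1) = 0 := by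
    simpa [qq] using h1
  rw [map_eq_zero_iff _ (RatFunc.algebraMap_injective ℚ)] at h2
  have := congrArg (Polynomial.eval 0) h2
  simp at this

theorem dg_rel (c : KK) : Bo c ^ 3 * Bi c
    - (qq ^ 2 + 1 + (qq⁻¹) ^ 2) • (Bo c ^ 2 * Bi c * Bo c)
    + (qq ^ 2 + 1 + (qq⁻¹) ^ 2) • (Bo c * Bi c * Bo c ^ 2) - Bi c * Bo c ^ 3
    = (-(qq * c * (qq + qq⁻¹) ^ 2)) • (Bo c * Bi c - Bi c * Bo c) := by
  have h := RingQuot.mkAlgHom_rel KK (qOnsRel.r0 (c := c))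
  simp only [map_sub, map_add, map_mul, map_pow, map_smul] at h
  exact h

/-- `B_δ` is fixed by `T₀Φ` (abstract form). -/
theorem tau_D {K A : Type*} [Field K] [Ring A] [Algebra K A] (q c : K) (hq : q ≠ 0) (hc : c ≠ 0)
    (h2 : q + q⁻¹ ≠ 0) (x y z : A)
    (hz : z = (q ^ 2 * (q + q⁻¹) * c)⁻¹ •
      (y * x ^ 2 - (q * (q + q⁻¹)) • (x * y * x) + q ^ 2 • (x ^ 2 * y)) + y)
    (h : x ^ 3 * y - (q ^ 2 + 1 + (q⁻¹) ^ 2) • (x ^ 2 * y * x)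
      + (q ^ 2 + 1 + (q⁻¹) ^ 2) • (x * y * x ^ 2) - y * x ^ 3
      = (-(q * c * (q + q⁻¹) ^ 2)) • (x * y - y * x)) :
    -(z * x) + (q⁻¹ ^ 2) • (x * z) = -(x * y) + (q⁻¹ ^ 2) • (y * x) := by
  have h2' : q ^ 2 + 1 ≠ 0 := by
    intro h; apply h2; field_simp; rw [h, mul_zero]
  have e : -(z * x) + (q⁻¹ ^ 2) • (x * z) = -(y * x) + (q⁻¹ ^ 2) • (x * y)
      + (q ^ 2 * (q + q⁻¹) * c)⁻¹ • (x ^ 3 * y - (q ^ 2 + 1 + (q⁻¹) ^ 2) • (x ^ 2 * y * x)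
      + (q ^ 2 + 1 + (q⁻¹) ^ 2) • (x * y * x ^ 2) - y * x ^ 3) := by
    subst hz
    simp only [mul_add, add_mul, mul_sub, sub_mul, smul_mul_assoc, mul_smul_comm, mul_assoc,
      pow_succ, pow_zero, one_mul]
    match_scalars <;> field_simp <;> ring
  rw [e, h]
  match_scalars <;> field_simp <;> ring

theorem ad_Da {K A : Type*} [Field K] [Ring A] [Algebra K A] (q c : K) (hq : q ≠ 0) (hc : c ≠ 0)
    (h2 : q + q⁻¹ ≠ 0) (x y z : A)
    (hz : z = (q ^ 2 * (q + q⁻¹) * c)⁻¹ •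
      (y * x ^ 2 - (q * (q + q⁻¹)) • (x * y * x) + q ^ 2 • (x ^ 2 * y)) + y) :
    (-(x * y) + (q⁻¹ ^ 2) • (y * x)) * x
      = x * (-(x * y) + (q⁻¹ ^ 2) • (y * x)) + ((q + q⁻¹) * c) • (z - y) := by
  have h2' : q ^ 2 + 1 ≠ 0 := by
    intro h; apply h2; field_simp; rw [h, mul_zero]
  subst hz
  simp only [mul_add, add_mul, neg_mul, mul_neg, smul_mul_assoc, mul_smul_comm, mul_assoc,
      pow_succ, pow_zero, one_mul]
  match_scalars <;> field_simp <;> ring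

theorem stmt18_aux (c : KK) (hc : c ≠ 0) (Φ T0 : QOns c ≃ₐ[KK] QOns c)
    (hΦ0 : Φ (Bo c) = Bi c) (hΦ1 : Φ (Bi c) = Bo c)
    (hT00 : T0 (Bo c) = Bo c) (hT01 : T0 (Bi c) = T0B1val c)
    (n : ℕ) (hn : 2 ≤ n)
    (hcom : ∀ k, 1 ≤ k → k < n → Bdel c * Bim c Φ T0 (k) - Bim c Φ T0 (k) * Bdel c = 0) :
    FFn c Φ T0 (n + 1) =
      Bi c * Bim c Φ T0 (n) + qq ^ 2 • (Bim c Φ T0 (n) * Bi c)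
        - Bim c Φ T0 (n - 1) * Bo c - qq ^ 2 • (Bo c * Bim c Φ T0 (n - 1))
        + Φ.symm (T0.symm (FFn c Φ T0 n)) := by
  obtain ⟨m, rfl⟩ : ∃ m, n = m + 2 := ⟨n - 2, by omega⟩
  let τ : QOns c ≃ₐ[KK] QOns c := Φ.trans T0
  have hτ : ∀ y, τ y = T0 (Φ y) := fun y => rfl
  have hτs : ∀ y, τ.symm y = Φ.symm (T0.symm y) := fun y => rfl
  let x : ℤ → QOns c := fun k => (τ ^ (-k)) (Bi c)
  have hx : ∀ k, τ (x k) = x (k - 1) := by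
    intro k
    change (τ * τ ^ (-k)) (Bi c) = (τ ^ (-(k - 1))) (Bi c)
    rw [← zpow_one_add]
    congr 2; ring
  have hx0 : x 0 = Bi c := rfl
  have hx1 : x (-1) = Bo c := by
    have := hx 0
    rw [hx0, hτ, hΦ1, hT00] at this
    simpa using this.symm
  have hx2 : x (-2) = T0 (Bi c) := by
    have := hx (-1)
    rw [hx1, hτ, hΦ0] at this
    simpa using this.symm
  have hs : ∀ y, (T1def c Φ T0).symm (Φ y) = τ.symm y := by
    intro y
    rw [AlgEquiv.symm_apply_eq, T1def]
    change Φ y = Φ (T0 (Φ (τ.symm y)))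
    rw [← hτ, AlgEquiv.apply_symm_apply]
  have hBa : ∀ k : ℕ, Ba1 c Φ T0 k = x k := by
    intro k
    induction k with
    | zero => simp [Ba1, hx0]
    | succ k ih =>
      rw [Ba1, Function.iterate_succ_apply', Function.comp_apply, hs, AlgEquiv.symm_apply_eq, hx]
      rw [Ba1] at ih
      rw [ih]
      simp
  have hCC : ∀ k : ℕ, CC c Φ T0 (k + 1)
      = PowerSeries.coeff k (PowerSeries.X * gX x 0 * gX x 0) := by
    intro k
    rw [coeff_X_gX, CC]
    simp only [hBa, Nat.add_sub_cancel, zero_add]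
    refine Finset.sum_congr rfl fun p _ => ?_
    rw [show k + 1 - 2 - p = k - 1 - p by omega]
  have hBim : ∀ k : ℕ, Bim c Φ T0 (k + 1) = PowerSeries.coeff k (gB qq x 0) := by
    intro k
    rw [Bim, gB, hCC, Nat.add_sub_cancel, hBa]
    simp only [map_add, map_neg, PowerSeries.coeff_smul, PowerSeries.coeff_C_mul,
      PowerSeries.coeff_mul_C, zero_sub, hx1]
    simp [gX]
  have hz : x (-2) = (qq ^ 2 * (qq + qq⁻¹) * c)⁻¹ •
      (x 0 * x (-1) ^ 2 - (qq * (qq + qq⁻¹)) • (x (-1) * x 0 * x (-1)) + qq ^ 2 • (x (-1) ^ 2 * x 0))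
        + x 0 := by
    rw [hx2, hT01, hx0, hx1, T0B1val]
  have hDd : Bdel c = -(x (-1) * x 0) + (qq⁻¹ ^ 2) • (x 0 * x (-1)) := by
    rw [hx0, hx1, Bdel]
  have hτD : τ (Bdel c) = Bdel c := by
    have h := tau_D qq c qq_ne hc two_ne (x (-1)) (x 0) (x (-2)) hz
      (by rw [hx0, hx1]; exact dg_rel c)
    rw [← hDd] at h
    rw [← h, h, hDd, map_add, map_neg, map_smul, map_mul, map_mul, hx, hx, ← hDd, ← h]
    norm_num
  have hk : Bdel c * x (-1) = x (-1) * Bdel c + ((qq + qq⁻¹) * c) • (x (-2) - x 0) := by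
    rw [hDd]
    exact ad_Da qq c qq_ne hc two_ne (x (-1)) (x 0) (x (-2)) hz
  have hmain := gf_main qq ((qq + qq⁻¹) * c) qq_ne (mul_ne_zero two_ne hc) τ x hx (Bdel c) hDd hτD
    hk m (fun k hkm => by
      have := hcom (k + 1) (by omega) (by omega)
      rwa [hBim] at this)
    (fun k => CC c Φ T0 (k + 1)) hCC
  simp only [hx0, hx1, hx2, ← hBim, hτ, hτs] at hmain
  exact hmain

/-- `F_{n+1} = B₁B_{nδ} + q²B_{nδ}B₁ − B_{(n−1)δ}B₀ − q²B₀B_{(n−1)δ} + (T₀Φ)⁻¹(F_n)`. -/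
theorem stmt18 (c : KK) (hc : c ≠ 0) (Φ T0 : QOns c ≃ₐ[KK] QOns c)
    (hΦ0 : Φ (Bo c) = Bi c) (hΦ1 : Φ (Bi c) = Bo c)
    (hT00 : T0 (Bo c) = Bo c) (hT01 : T0 (Bi c) = T0B1val c)
    (n : ℕ) (hn : 2 ≤ n)
    (hcom : ∀ k, 1 ≤ k → k < n → Bdel c * Bim c Φ T0 (k) - Bim c Φ T0 (k) * Bdel c = 0) :
    FFn c Φ T0 (n + 1) =
      Bi c * Bim c Φ T0 (n) + qq ^ 2 • (Bim c Φ T0 (n) * Bi c)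
        - Bim c Φ T0 (n - 1) * Bo c - qq ^ 2 • (Bo c * Bim c Φ T0 (n - 1))
        + Φ.symm (T0.symm (FFn c Φ T0 n)) := by
  exact stmt18_aux c hc Φ T0 hΦ0 hΦ1 hT00 hT01 n hn hcom

end
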